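/- Derivative of the quantum square of the Euler field along the quantum volume element: ∇_Δ E² = Δ∘G(E) − G(Δ)∘E − G(Δ∘E) + (b₁+2) Δ∘E, where E² := E∘E and ∇_Δ is the componentwise derivative in the direction Δ with respect to the trivial connection ∇ (∇γ_α = 0). -/

import Mathlib

open scoped BigOperators

/-- Points of the small phase space `ℂ^N`. -/
abbrev Pt (N : ℕ) := Fin N → ℂ

/-- Vector fields on `ℂ^N` (components with respect to the basis `γ_α`). -/
abbrev VF (N : ℕ) := Pt N → Pt N

/-- Partial derivative `∂/∂t^α`. -/
noncomputable def pd {N : ℕ} (α : Fin N) (F : Pt N → ℂ) : Pt N → ℂ :=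
  fun t => fderiv ℂ F t (Pi.single α 1)

/-- The `k`-point function `⟨⟨v₁ ⋯ v_k⟩⟩` associated with a generating function `F`. -/
noncomputable def corr {N : ℕ} : (Pt N → ℂ) → List (VF N) → Pt N → ℂ
  | F, [] => F
  | F, v :: vs => fun t => ∑ α, v t α * corr (pd α F) vs t

/-- Constant vector field associated with an element of `ℂ^N`. -/
def cvf {N : ℕ} (x : Pt N) : VF N := fun _ => x

/-- The basis vector field `γ_α`. -/
noncomputable def bas {N : ℕ} (α : Fin N) : VF N := cvf (Pi.single α 1)

/-- The dual basis vector field `γ^α = η^{αβ} γ_β`. -/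
noncomputable def dua {N : ℕ} (ηinv : Matrix (Fin N) (Fin N) ℂ) (α : Fin N) : VF N :=
  cvf (fun β => ηinv α β)

/-- The quantum product `v ∘ w := ⟨⟨v w γ^α⟩⟩₀ γ_α` of two vector fields. -/
noncomputable def qp {N : ℕ} (F : Pt N → ℂ) (ηinv : Matrix (Fin N) (Fin N) ℂ)
    (v w : VF N) : VF N :=
  fun t σ => corr F [v, w, dua ηinv σ] t

/-- The grading operator `G(Σ f_α γ_α) = Σ b_α f_α γ_α`. -/
def Gop {N : ℕ} (b : Fin N → ℂ) (v : VF N) : VF N := fun t α => b α * v t α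

/-- The Euler vector field `E = c + Σ_α (b₁ + 1 - b_α) t^α γ_α`. -/
def euler {N : ℕ} (c : Pt N) (b : Fin N → ℂ) (b1 : ℂ) : VF N :=
  fun t α => c α + (b1 + 1 - b α) * t α

/-- The quantum volume element `Δ := γ^α ∘ γ_α`. -/
noncomputable def qvol {N : ℕ} (F : Pt N → ℂ) (ηinv : Matrix (Fin N) (Fin N) ℂ) : VF N :=
  fun t => ∑ α, qp F ηinv (dua ηinv α) (bas α) t

/-- Covariant derivative `∇_v w` with respect to the trivial connection (`∇ γ_α = 0`). -/
noncomputable def nablaVF {N : ℕ} (v w : VF N) : VF N :=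
  fun t α => fderiv ℂ (fun s => w s α) t (v t)

/-- Derivative of a function along a vector field. -/
noncomputable def dirD {N : ℕ} (v : VF N) (f : Pt N → ℂ) : Pt N → ℂ :=
  fun t => fderiv ℂ f t (v t)

/-- Quantum powers of a vector field: `E⁰ := γ₁`, `E^{k+1} := E ∘ E^k`. -/
noncomputable def epow {N : ℕ} [NeZero N] (F : Pt N → ℂ) (ηinv : Matrix (Fin N) (Fin N) ℂ)
    (E : VF N) : ℕ → VF N
  | 0 => bas 0
  | k + 1 => qp F ηinv E (epow F ηinv E k)

/-- The genus-0 part `G₀` of Getzler's equation. -/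
noncomputable def G0func {N : ℕ} (F0 : Pt N → ℂ) (ηinv : Matrix (Fin N) (Fin N) ℂ)
    (v : Fin 4 → VF N) (t : Pt N) : ℂ :=
  ∑ g : Equiv.Perm (Fin 4),
    ((1/6) * ∑ α, corr F0 [v (g 0), v (g 1), v (g 2), dua ηinv α] t *
        (∑ β, corr F0 [bas α, v (g 3), bas β, dua ηinv β] t)
    + (1/24) * ∑ α, corr F0 [v (g 0), v (g 1), v (g 2), v (g 3), dua ηinv α] t *
        (∑ β, corr F0 [bas α, bas β, dua ηinv β] t)
    - (1/4) * ∑ α, ∑ β, corr F0 [v (g 0), v (g 1), dua ηinv α, dua ηinv β] t *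
        corr F0 [bas α, bas β, v (g 2), v (g 3)] t)

/-- The genus-1 part `G₁` of Getzler's equation. -/
noncomputable def G1func {N : ℕ} (F0 F1 : Pt N → ℂ) (ηinv : Matrix (Fin N) (Fin N) ℂ)
    (v : Fin 4 → VF N) (t : Pt N) : ℂ :=
  ∑ g : Equiv.Perm (Fin 4),
    (3 * corr F1 [qp F0 ηinv (v (g 0)) (v (g 1)), qp F0 ηinv (v (g 2)) (v (g 3))] t
    - 4 * corr F1 [qp F0 ηinv (qp F0 ηinv (v (g 0)) (v (g 1))) (v (g 2)), v (g 3)] t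
    - ∑ α, corr F0 [qp F0 ηinv (v (g 0)) (v (g 1)), v (g 2), v (g 3), dua ηinv α] t *
        corr F1 [bas α] t
    + 2 * ∑ α, corr F0 [v (g 0), v (g 1), v (g 2), dua ηinv α] t *
        corr F1 [qp F0 ηinv (bas α) (v (g 3))] t)

section EulerHomogeneity

variable {N : ℕ}

lemma analyticAt_pd {f : Pt N → ℂ} (hf : ∀ t, AnalyticAt ℂ f t) (α : Fin N) (t : Pt N) :
    AnalyticAt ℂ (pd α f) t :=
  ((ContinuousLinearMap.apply ℂ ℂ (Pi.single α (1 : ℂ) : Pt N)).analyticAt _).comp (hf t).fderiv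

lemma pd_comm {f : Pt N → ℂ} (hf : ∀ t, AnalyticAt ℂ f t) (α β : Fin N) :
    pd α (pd β f) = pd β (pd α f) := by
  funext t
  have hd : DifferentiableAt ℂ (fderiv ℂ f) t := (hf t).fderiv.differentiableAt
  have key (γ δ : Fin N) : pd γ (pd δ f) t
      = fderiv ℂ (fderiv ℂ f) t (Pi.single γ 1) (Pi.single δ 1) := by
    have h := hd.hasFDerivAt.clm_apply (hasFDerivAt_const (Pi.single δ (1 : ℂ) : Pt N) t)
    rw [show pd γ (pd δ f) t = fderiv ℂ (fun s => fderiv ℂ f s (Pi.single δ 1)) t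
      (Pi.single γ 1) from rfl, h.fderiv]
    simp
  rw [key, key]
  have hs : IsSymmSndFDerivAt ℂ f t := (hf t).contDiffAt.isSymmSndFDerivAt (n := ⊤) (by simp)
  exact hs _ _

lemma fderiv_apply_eq_sum_pd (f : Pt N → ℂ) (t v : Pt N) :
    fderiv ℂ f t v = ∑ μ, v μ * pd μ f t := by
  conv_lhs => rw [pi_eq_sum_univ' v]
  simp [pd]

lemma hasFDerivAt_euler (c : Pt N) (b : Fin N → ℂ) (b1 : ℂ) (α : Fin N) (t : Pt N) :
    HasFDerivAt (fun s => euler c b b1 s α)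
      ((b1 + 1 - b α) • (ContinuousLinearMap.proj α : Pt N →L[ℂ] ℂ)) t :=
  (((ContinuousLinearMap.proj α : Pt N →L[ℂ] ℂ).hasFDerivAt).const_mul _).const_add _

/-- Differentiating a quasi-homogeneity relation shifts the weight. -/
lemma euler_pd {f h : Pt N → ℂ} (hf : ∀ t, AnalyticAt ℂ f t) (hh : ∀ t, AnalyticAt ℂ h t)
    {c : Pt N} {b : Fin N → ℂ} {b1 k : ℂ}
    (hE : ∀ t, ∑ μ, euler c b b1 t μ * pd μ f t = k * f t + h t) (α : Fin N) (t : Pt N) :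
    ∑ μ, euler c b b1 t μ * pd μ (pd α f) t
      = (k - (b1 + 1 - b α)) * pd α f t + pd α h t := by
  have hl : HasFDerivAt (fun s => ∑ μ, euler c b b1 s μ * pd μ f s) _ t :=
    HasFDerivAt.fun_sum fun μ _ => (hasFDerivAt_euler c b b1 μ t).fun_mul
      (analyticAt_pd hf μ t).differentiableAt.hasFDerivAt
  have hr := ((hf t).differentiableAt.hasFDerivAt.const_mul k).add
    (hh t).differentiableAt.hasFDerivAt
  rw [funext hE] at hl
  have key := DFunLike.congr_fun (hl.unique hr) (Pi.single α (1 : ℂ) : Pt N)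
  have hc (μ : Fin N) : fderiv ℂ (pd μ f) t (Pi.single α 1) = pd μ (pd α f) t := by
    rw [pd_comm hf μ α]; rfl
  simp only [sum_apply, add_apply,
    smul_apply, ContinuousLinearMap.proj_apply, smul_eq_mul, hc,
    Finset.sum_add_distrib, Pi.single_apply, mul_ite, mul_one, mul_zero,
    Finset.sum_ite_eq', Finset.mem_univ, if_true] at key
  change _ = k * pd α f t + pd α h t at key
  linear_combination key

lemma pd_pd_pd_quadratic (C : Matrix (Fin N) (Fin N) ℂ) (α β γ : Fin N) :
    pd γ (pd β (pd α (fun t => (1/2) * ∑ μ, ∑ ν, C μ ν * t μ * t ν))) = 0 := by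
  have hp (μ : Fin N) (t : Pt N) :
      HasFDerivAt (fun s : Pt N => s μ) (ContinuousLinearMap.proj μ : Pt N →L[ℂ] ℂ) t :=
    (ContinuousLinearMap.proj μ : Pt N →L[ℂ] ℂ).hasFDerivAt
  have h1 : pd α (fun t => (1/2) * ∑ μ, ∑ ν, C μ ν * t μ * t ν)
      = fun t => ∑ μ, (1/2) * (C α μ + C μ α) * t μ := by
    funext t
    have h := (HasFDerivAt.fun_sum (u := Finset.univ) fun μ _ => HasFDerivAt.fun_sum
      (u := Finset.univ) fun ν _ => ((hp μ t).const_mul (C μ ν)).fun_mul (hp ν t)).const_mul (1/2 : ℂ)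
    rw [pd, h.fderiv]
    simp [Pi.single_apply, Finset.sum_add_distrib, Finset.mul_sum, add_mul, mul_add]
    rw [add_comm]
    congr 1 <;> exact Finset.sum_congr rfl fun _ _ => by ring
  have h2 : pd β (fun t : Pt N => ∑ μ, (1/2) * (C α μ + C μ α) * t μ)
      = fun _ => (1/2) * (C α β + C β α) := by
    funext t
    have h := HasFDerivAt.fun_sum (u := Finset.univ) fun μ _ =>
      (hp μ t).const_mul ((1/2) * (C α μ + C μ α))
    rw [pd, h.fderiv]
    simp [Pi.single_apply]
  rw [h1, h2]
  funext t
  simp [pd]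

lemma analyticAt_quadratic (C : Matrix (Fin N) (Fin N) ℂ) (t : Pt N) :
    AnalyticAt ℂ (fun t : Pt N => (1/2) * ∑ μ, ∑ ν, C μ ν * t μ * t ν) t := by
  have hp (μ : Fin N) : AnalyticAt ℂ (fun s : Pt N => s μ) t :=
    (ContinuousLinearMap.proj μ : Pt N →L[ℂ] ℂ).analyticAt t
  exact analyticAt_const.mul (Finset.analyticAt_fun_sum _ fun μ _ =>
    Finset.analyticAt_fun_sum _ fun ν _ => (analyticAt_const.mul (hp μ)).mul (hp ν))

/-- Third derivatives of a quasi-homogeneous function are eigenfunctions of the Euler field. -/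
lemma euler_pd_pd_pd {F : Pt N → ℂ} (hF : ∀ t, AnalyticAt ℂ F t)
    {c : Pt N} {b : Fin N → ℂ} {b1 : ℂ} {C : Matrix (Fin N) (Fin N) ℂ}
    (hE : ∀ t, fderiv ℂ F t (euler c b b1 t)
      = 2 * (b1 + 1) * F t + (1/2) * ∑ α, ∑ β, C α β * t α * t β)
    (α β γ : Fin N) (t : Pt N) :
    ∑ μ, euler c b b1 t μ * pd μ (pd γ (pd β (pd α F))) t
      = (b α + b β + b γ - (b1 + 1)) * pd γ (pd β (pd α F)) t := by
  have hq := analyticAt_quadratic C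
  have h := euler_pd (analyticAt_pd (analyticAt_pd hF α) β) (analyticAt_pd (analyticAt_pd hq α) β)
    (euler_pd (analyticAt_pd hF α) (analyticAt_pd hq α)
      (euler_pd hF hq (fun t => (fderiv_apply_eq_sum_pd F t _).symm.trans (hE t)) α) β) γ t
  rw [h, pd_pd_pd_quadratic]
  simp only [Pi.zero_apply]
  ring

lemma qp_apply (F : Pt N → ℂ) (ηinv : Matrix (Fin N) (Fin N) ℂ) (v w : VF N) (t : Pt N)
    (σ : Fin N) :
    qp F ηinv v w t σ
      = ∑ α, ∑ β, ∑ γ, ηinv σ γ * (v t α * w t β * pd γ (pd β (pd α F)) t) := by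
  simp only [qp, corr, dua, cvf, Finset.mul_sum]
  exact Finset.sum_congr rfl fun _ _ => Finset.sum_congr rfl fun _ _ =>
    Finset.sum_congr rfl fun _ _ => by ring

/-- Leibniz rule for the derivative of the quantum square of the Euler field. -/
lemma nablaVF_qp_euler {F : Pt N → ℂ} (hF : ∀ t, AnalyticAt ℂ F t)
    (ηinv : Matrix (Fin N) (Fin N) ℂ) (c : Pt N) (b : Fin N → ℂ) (b1 : ℂ) (v : VF N)
    (t : Pt N) (σ : Fin N) :
    nablaVF v (qp F ηinv (euler c b b1) (euler c b b1)) t σ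
      = ∑ α, ∑ β, ∑ γ, ηinv σ γ *
        (((b1 + 1 - b α) * v t α * euler c b b1 t β
          + euler c b b1 t α * ((b1 + 1 - b β) * v t β)) * pd γ (pd β (pd α F)) t
        + euler c b b1 t α * euler c b b1 t β * ∑ μ, v t μ * pd μ (pd γ (pd β (pd α F))) t) := by
  have h := HasFDerivAt.fun_sum (u := Finset.univ) fun α _ => HasFDerivAt.fun_sum
    (u := Finset.univ) fun β _ => HasFDerivAt.fun_sum (u := Finset.univ) fun γ _ =>
      (((hasFDerivAt_euler c b b1 α t).fun_mul (hasFDerivAt_euler c b b1 β t)).fun_mul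
        (analyticAt_pd (analyticAt_pd (analyticAt_pd hF α) β) γ
          t).differentiableAt.hasFDerivAt).const_mul (ηinv σ γ)
  simp only [nablaVF, qp_apply]
  rw [h.fderiv]
  simp only [sum_apply, add_apply,
    smul_apply, ContinuousLinearMap.proj_apply, smul_eq_mul,
    fderiv_apply_eq_sum_pd]
  exact Finset.sum_congr rfl fun _ _ => Finset.sum_congr rfl fun _ _ =>
    Finset.sum_congr rfl fun _ _ => by ring

/-- Quasi-homogeneity of the quantum product, contracted with the Euler field twice. -/
lemma sum_euler_euler_pd {F : Pt N → ℂ} (hF : ∀ t, AnalyticAt ℂ F t)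
    {c : Pt N} {b : Fin N → ℂ} {b1 : ℂ} {C : Matrix (Fin N) (Fin N) ℂ}
    (hE : ∀ t, fderiv ℂ F t (euler c b b1 t)
      = 2 * (b1 + 1) * F t + (1/2) * ∑ α, ∑ β, C α β * t α * t β)
    (ηinv : Matrix (Fin N) (Fin N) ℂ) (v : VF N) (t : Pt N) (σ : Fin N) :
    ∑ α, ∑ β, ∑ γ, ηinv σ γ * (euler c b b1 t α * euler c b b1 t β *
        ∑ μ, v t μ * pd μ (pd γ (pd β (pd α F))) t)
      = ∑ α, ∑ β, ∑ γ, ηinv σ γ * ((b α + b β + b γ - (b1 + 1)) *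
        (v t α * euler c b b1 t β * pd γ (pd β (pd α F)) t)) := by
  have hswap (α β γ μ : Fin N) : pd μ (pd γ (pd β (pd α F))) = pd α (pd γ (pd β (pd μ F))) := by
    rw [pd_comm hF β α, pd_comm (analyticAt_pd hF β) γ α,
      pd_comm (analyticAt_pd (analyticAt_pd hF β) γ) μ α,
      pd_comm (analyticAt_pd hF β) μ γ, pd_comm hF μ β]
  calc _ = ∑ α, ∑ μ, ∑ β, ∑ γ, ηinv σ γ * (v t μ * euler c b b1 t β *
        (euler c b b1 t α * pd α (pd γ (pd β (pd μ F))) t)) := by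
        refine Finset.sum_congr rfl fun α _ => Eq.symm ?_
        rw [Finset.sum_comm]
        refine Finset.sum_congr rfl fun β _ => ?_
        rw [Finset.sum_comm]
        refine Finset.sum_congr rfl fun γ _ => ?_
        simp only [Finset.mul_sum]
        refine Finset.sum_congr rfl fun μ _ => ?_
        rw [hswap α β γ μ]
        ring
    _ = _ := by
        rw [Finset.sum_comm]
        refine Finset.sum_congr rfl fun μ _ => ?_
        rw [Finset.sum_comm]
        refine Finset.sum_congr rfl fun β _ => ?_
        rw [Finset.sum_comm]
        refine Finset.sum_congr rfl fun γ _ => ?_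
        rw [← Finset.mul_sum, ← Finset.mul_sum, euler_pd_pd_pd hF hE]
        ring

end EulerHomogeneity

/-- Derivative of the quantum square of the Euler field along the quantum volume element:
`∇_Δ E² = Δ∘G(E) − G(Δ)∘E − G(Δ∘E) + (b₁+2) Δ∘E`. -/
theorem nabla_qvol_euler_sq
    {N : ℕ} [NeZero N]
    (ηm ηinv : Matrix (Fin N) (Fin N) ℂ)
    (hηsym : ηm.IsSymm)
    (hη1 : ηm * ηinv = 1) (hη2 : ηinv * ηm = 1)
    (b : Fin N → ℂ)
    (hb : ∀ α β, ηinv α β ≠ 0 → b α + b β = 1)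
    (c : Pt N) (C : Matrix (Fin N) (Fin N) ℂ) (hC : C.IsSymm)
    (F0 : Pt N → ℂ)
    (hF0 : ∀ t, AnalyticAt ℂ F0 t)
    (hid : ∀ v : VF N, qp F0 ηinv (bas 0) v = v)
    (hwdvv : ∀ u v w : VF N,
      qp F0 ηinv (qp F0 ηinv u v) w = qp F0 ηinv u (qp F0 ηinv v w))
    (hqh0 : ∀ t, fderiv ℂ F0 t (euler c b (b 0) t)
      = 2 * (b 0 + 1) * F0 t + (1/2) * ∑ α, ∑ β, C α β * t α * t β) :
    ∀ t : Pt N,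
      nablaVF (qvol F0 ηinv)
          (qp F0 ηinv (euler c b (b 0)) (euler c b (b 0))) t
        = qp F0 ηinv (qvol F0 ηinv) (Gop b (euler c b (b 0))) t
          - qp F0 ηinv (Gop b (qvol F0 ηinv)) (euler c b (b 0)) t
          - Gop b (qp F0 ηinv (qvol F0 ηinv) (euler c b (b 0))) t
          + (b 0 + 2) • qp F0 ηinv (qvol F0 ηinv) (euler c b (b 0)) t := by
  intro t
  funext σ
  have hs : ∑ α, ∑ β, ∑ γ, ηinv σ γ * (euler c b (b 0) t α *
        ((b 0 + 1 - b β) * qvol F0 ηinv t β) * pd γ (pd β (pd α F0)) t)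
      = ∑ α, ∑ β, ∑ γ, ηinv σ γ * ((b 0 + 1 - b α) * qvol F0 ηinv t α *
        euler c b (b 0) t β * pd γ (pd β (pd α F0)) t) := by
    rw [Finset.sum_comm]
    refine Finset.sum_congr rfl fun α _ => Finset.sum_congr rfl fun β _ =>
      Finset.sum_congr rfl fun γ _ => ?_
    rw [pd_comm hF0 α β]
    ring
  simp only [nablaVF_qp_euler hF0, mul_add, add_mul, Finset.sum_add_distrib] at hs ⊢
  rw [sum_euler_euler_pd hF0 hqh0]
  simp only [Pi.add_apply, Pi.sub_apply, Pi.smul_apply, smul_eq_mul, Gop, qp_apply] at hs ⊢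
  rw [hs]
  simp only [Finset.mul_sum, ← Finset.sum_add_distrib, ← Finset.sum_sub_distrib]
  refine Finset.sum_congr rfl fun α _ => Finset.sum_congr rfl fun β _ =>
    Finset.sum_congr rfl fun γ _ => ?_
  by_cases hz : ηinv σ γ = 0
  · simp [hz]
  · linear_combination (ηinv σ γ * (qvol F0 ηinv t α * euler c b (b 0) t β *
      pd γ (pd β (pd α F0)) t)) * hb σ γ hz
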